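/- Let A be a d-by-d matrix with independent entries each uniform on {−1, +1}. Then the probability that A is singular is at most α^d for some absolute constant α < 1. -/

import Mathlib

open Matrix
namespace KKS
open Finset

noncomputable def ind (P : Prop) : ℝ := open Classical in if P then 1 else 0

lemma ind_pos {P : Prop} (h : P) : ind P = 1 := by simp [ind, h]
lemma ind_neg {P : Prop} (h : ¬ P) : ind P = 0 := by simp [ind, h]
lemma ind_nonneg (P : Prop) : 0 ≤ ind P := by unfold ind; split_ifs <;> norm_num
lemma ind_le_one (P : Prop) : ind P ≤ 1 := by unfold ind; split_ifs <;> norm_num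
lemma ind_mono {P Q : Prop} (h : P → Q) : ind P ≤ ind Q := by
  by_cases hP : P
  · rw [ind_pos hP, ind_pos (h hP)]
  · rw [ind_neg hP]; exact ind_nonneg Q
lemma ind_and (P Q : Prop) : ind (P ∧ Q) = ind P * ind Q := by
  by_cases hP : P <;> by_cases hQ : Q <;> simp [ind, hP, hQ]
lemma ind_not (P : Prop) : ind (¬ P) = 1 - ind P := by
  by_cases hP : P <;> simp [ind, hP]
lemma ind_congr {P Q : Prop} (h : P ↔ Q) : ind P = ind Q := by rw [propext h]
lemma sum_ind_eq {α : Type*} [Fintype α] (a : α) (F : α → ℝ) :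
    ∑ u, ind (u = a) * F u = F a := by
  classical
  simp [ind]

section Fourier
variable {p : ℕ} [Fact p.Prime]

noncomputable def ct (x : ZMod p) : ℝ := (ZMod.stdAddChar x : ℂ).re
noncomputable def st (x : ZMod p) : ℝ := (ZMod.stdAddChar x : ℂ).im

lemma cs_sq (x : ZMod p) : ct x ^ 2 + st x ^ 2 = 1 := by
  have h : ‖(ZMod.stdAddChar x : ℂ)‖ = 1 := AddChar.norm_apply _ _
  have h2 := Complex.sq_norm (ZMod.stdAddChar x : ℂ)
  rw [h, Complex.normSq_apply] at h2
  unfold ct st; nlinarith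

lemma st_add (x y : ZMod p) : st (x + y) = st x * ct y + ct x * st y := by
  unfold ct st
  rw [AddChar.map_add_eq_mul, Complex.mul_im]; ring

lemma ct_add (x y : ZMod p) : ct (x + y) = ct x * ct y - st x * st y := by
  unfold ct st
  rw [AddChar.map_add_eq_mul, Complex.mul_re]

lemma ct_zero : ct (0 : ZMod p) = 1 := by simp [ct]
lemma st_zero : st (0 : ZMod p) = 0 := by simp [st]

lemma chi_neg (x : ZMod p) : (ZMod.stdAddChar x : ℂ) + ZMod.stdAddChar (-x) = ((2 * ct x : ℝ) : ℂ) := by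
  rw [AddChar.map_neg_eq_conj, Complex.add_conj]; simp [ct]

lemma st_sq_le (x : ZMod p) : st x ^ 2 ≤ 1 := by nlinarith [cs_sq x, sq_nonneg (ct x)]
lemma st_add_sq (x y : ZMod p) : st (x + y) ^ 2 ≤ 2 * (st x ^ 2 + st y ^ 2) := by
  rw [st_add]
  nlinarith [cs_sq x, cs_sq y, sq_nonneg (st x * ct y - ct x * st y),
    mul_nonneg (sq_nonneg (st x)) (sq_nonneg (st y))]

lemma abs_ct_le (x : ZMod p) : |ct x| ≤ 1 - st x ^ 2 / 2 := by
  have := cs_sq x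
  refine abs_le_of_sq_le_sq ?_ (by linarith [st_sq_le x])
  nlinarith [sq_nonneg (st x ^ 2)]

lemma key1 (x y : ZMod p) : |ct x| * |ct y| ≤ (1 - st (x + y) ^ 2 / 8) ^ 2 := by
  have h1 := abs_ct_le x
  have h2 := abs_ct_le y
  have h3 := st_add_sq x y
  have h4 := st_sq_le (x + y)
  have := abs_nonneg (ct x)
  have := abs_nonneg (ct y)
  have h5 := cs_sq x
  have h6 := cs_sq y
  rw [← sq_abs (ct x)] at h5
  rw [← sq_abs (ct y)] at h6
  nlinarith [sq_nonneg (|ct x| - |ct y|), sq_nonneg (st (x + y) ^ 2)]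

lemma key2 (x y : ZMod p) : (1 - st x ^ 2 / 8) * (1 - st y ^ 2 / 8) ≤
    (1 - st (x + y) ^ 2 / 32) ^ 2 := by
  have h3 := st_add_sq x y
  have h4 := st_sq_le (x + y)
  have h5 := st_sq_le x
  have h6 := st_sq_le y
  have h7 : 0 ≤ 1 - (st x ^ 2 + st y ^ 2) / 16 := by linarith
  have h8 : 1 - (st x ^ 2 + st y ^ 2) / 16 ≤ 1 - st (x + y) ^ 2 / 32 := by linarith
  have h9 := pow_le_pow_left₀ h7 h8 2
  nlinarith [sq_nonneg (st x ^ 2 - st y ^ 2)]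

lemma key3 (x : ZMod p) : |ct x| ≤ (1 - st x ^ 2 / 32) ^ 16 := by
  have h1 := abs_ct_le x
  have h5 := st_sq_le x
  have h := one_add_mul_le_pow (a := -(st x ^ 2 / 32)) (by linarith) 16
  have e : (1 - st x ^ 2 / 32) = 1 + -(st x ^ 2 / 32) := by ring
  rw [e]; push_cast at h; linarith

open Pointwise in
lemma level (f g : ZMod p → ℝ) (t : ℝ) (h : ∀ x y, t ≤ f x → t ≤ f y → t ≤ g (x + y))
    (h0 : t ≤ f 0) : min p (2 * #{x | t ≤ f x} - 1) ≤ #{x | t ≤ g x} := by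
  classical
  have hne : ({x | t ≤ f x} : Finset (ZMod p)).Nonempty := ⟨0, by simpa using h0⟩
  have := ZMod.cauchy_davenport (Fact.out : p.Prime) hne hne
  rw [← two_mul] at this
  refine this.trans (card_le_card ?_)
  intro z hz
  obtain ⟨x, hx, y, hy, rfl⟩ := mem_add.1 hz
  simp only [mem_filter, mem_univ, true_and] at *
  exact h x y hx hy

open MeasureTheory in
lemma layer_int (y : ℝ) : IntegrableOn (fun t : ℝ => ind (t ≤ y)) (Set.Ioc 0 1) := by
  have : (fun t : ℝ => ind (t ≤ y)) = Set.indicator (Set.Iic y) (fun _ => (1:ℝ)) := by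
    ext t; by_cases h : t ≤ y <;> simp [ind, h]
  rw [this]
  refine IntegrableOn.indicator ?_ measurableSet_Iic
  simp

open MeasureTheory in
lemma layer1 (y : ℝ) (h0 : 0 ≤ y) (h1 : y ≤ 1) : ∫ t in Set.Ioc (0:ℝ) 1, ind (t ≤ y) = y := by
  have : (fun t : ℝ => ind (t ≤ y)) = Set.indicator (Set.Iic y) (fun _ => (1:ℝ)) := by
    ext t; by_cases h : t ≤ y <;> simp [ind, h]
  rw [this, setIntegral_indicator measurableSet_Iic]
  have : Set.Ioc 0 1 ∩ Set.Iic y = Set.Ioc 0 y := by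
    ext t; simp; intro _ h; linarith
  rw [this]; simp [h0]

open MeasureTheory in
lemma layer {α : Type*} [Fintype α] (u v : α → ℝ) (hu0 : ∀ x, 0 ≤ u x) (hu : ∀ x, u x ≤ 1)
    (hv0 : ∀ x, 0 ≤ v x) (hv : ∀ x, v x ≤ 1)
    (h : ∀ t, 0 < t → t ≤ 1 → 4 * ∑ x, ind (t ≤ u x) ≤ ∑ x, ind (t ≤ v x) + 3) :
    4 * ∑ x, u x ≤ ∑ x, v x + 3 := by
  have e1 : ∑ x, u x = ∫ t in Set.Ioc (0:ℝ) 1, ∑ x, ind (t ≤ u x) := by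
    rw [integral_finsetSum _ (fun x _ => layer_int (u x))]
    exact Finset.sum_congr rfl (fun x _ => (layer1 _ (hu0 x) (hu x)).symm)
  have e2 : ∑ x, v x = ∫ t in Set.Ioc (0:ℝ) 1, ∑ x, ind (t ≤ v x) := by
    rw [integral_finsetSum _ (fun x _ => layer_int (v x))]
    exact Finset.sum_congr rfl (fun x _ => (layer1 _ (hv0 x) (hv x)).symm)
  have i1 : IntegrableOn (fun t : ℝ => ∑ x, ind (t ≤ u x)) (Set.Ioc 0 1) :=
    integrable_finsetSum _ (fun x _ => layer_int (u x))
  have i2 : IntegrableOn (fun t : ℝ => ∑ x, ind (t ≤ v x)) (Set.Ioc 0 1) :=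
    integrable_finsetSum _ (fun x _ => layer_int (v x))
  have i3 : IntegrableOn (fun _ : ℝ => (3:ℝ)) (Set.Ioc 0 1) := by simp
  have e3 : (3:ℝ) = ∫ t in Set.Ioc (0:ℝ) 1, (3:ℝ) := by simp
  rw [e1, e2, e3, ← integral_add i2 i3, ← integral_const_mul]
  exact setIntegral_mono_on (i1.const_mul 4) (i2.add i3) measurableSet_Ioc
    (fun t ht => h t ht.1 ht.2)

lemma sum_ind_card {α : Type*} [Fintype α] (P : α → Prop) [DecidablePred P] :
    ∑ x, ind (P x) = (#{x | P x} : ℝ) := by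
  rw [Finset.card_filter]
  push_cast
  refine sum_congr rfl (fun x _ => ?_)
  by_cases h : P x <;> simp [ind, h]

/-- the abstract Halasz type comparison -/
lemma compare (f h g : ZMod p → ℝ) (hf0 : ∀ x, 0 ≤ f x) (hf1 : ∀ x, f x ≤ 1)
    (hh0 : ∀ x, 0 ≤ h x)
    (hg0 : ∀ x, 0 ≤ g x) (hg1 : ∀ x, g x ≤ 1) (f0 : f 0 = 1) (h0 : h 0 = 1)
    (k1 : ∀ x y, f x * f y ≤ h (x + y) ^ 2) (k2 : ∀ x y, h x * h y ≤ g (x + y) ^ 2)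
    (k3 : ∀ x, f x ≤ g x ^ 16) (hs : ∑ x, g x < 0.6 * p) :
    ∑ x, f x ≤ 0.87 * ∑ x, g x + 0.75 := by
  classical
  let u : ZMod p → ℝ := fun x => if 0.6 ≤ f x then f x else 0
  have main : 4 * ∑ x, u x ≤ ∑ x, g x + 3 := by
    refine layer u g ?_ ?_ hg0 hg1 ?_
    · intro x; simp only [u]; split_ifs <;> [exact hf0 x; rfl]
    · intro x; simp only [u]; split_ifs <;> [exact hf1 x; norm_num]
    intro t ht0 ht1
    set T := max t 0.6 with hT
    have hT1 : T ≤ 1 := max_le ht1 (by norm_num)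
    have hT6 : 0.6 ≤ T := le_max_right _ _
    have hTt : t ≤ T := le_max_left _ _
    have l1 := level f h T (fun x y hx hy => by
      have := k1 x y
      have : T ^ 2 ≤ h (x + y) ^ 2 := by nlinarith
      exact (pow_le_pow_iff_left₀ (by linarith) (hh0 _) (by norm_num)).1 this) (by rw [f0]; exact hT1)
    have l2 := level h g T (fun x y hx hy => by
      have := k2 x y
      have : T ^ 2 ≤ g (x + y) ^ 2 := by nlinarith
      exact (pow_le_pow_iff_left₀ (by linarith) (hg0 _) (by norm_num)).1 this) (by rw [h0]; exact hT1)
    have l3 : #{x | T ≤ g x} < p := by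
      by_contra hc
      have hc' : #{x | T ≤ g x} = #(univ : Finset (ZMod p)) := by
        refine le_antisymm (card_le_card (subset_univ _)) ?_
        rw [Finset.card_univ, ZMod.card]; omega
      have hall := (Finset.card_filter_eq_iff.1 hc')
      have : ∑ x : ZMod p, (0.6 : ℝ) ≤ ∑ x, g x :=
        sum_le_sum (fun x hx => hT6.trans (hall x hx))
      simp only [sum_const, Finset.card_univ, ZMod.card, nsmul_eq_mul] at this
      linarith
    have l4 : 4 * #{x | T ≤ f x} ≤ #{x | T ≤ g x} + 3 := by omega
    have e1 : ∑ x, ind (t ≤ u x) = ∑ x, ind (T ≤ f x) := by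
      refine sum_congr rfl (fun x _ => ind_congr ?_)
      simp only [u, hT]
      split_ifs with hh
      · simp [hh]
      · constructor
        · intro; linarith
        · intro hx; exact absurd ((le_max_right _ _).trans hx) hh
    have e2 : ∑ x, ind (T ≤ g x) ≤ ∑ x, ind (t ≤ g x) :=
      sum_le_sum (fun x _ => ind_mono (fun hx => hTt.trans hx))
    rw [e1]
    refine le_trans ?_ (add_le_add_left e2 3)
    rw [sum_ind_card, sum_ind_card]
    exact_mod_cast l4
  have pt : ∀ x, f x ≤ u x + 0.62 * g x := by
    intro x
    simp only [u]
    split_ifs with hx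
    · linarith [hg0 x]
    · push Not at hx
      by_cases hgx : 0.968 ≤ g x
      · linarith
      · push Not at hgx
        have h15 : g x ^ 15 ≤ 0.62 := (pow_le_pow_left₀ (hg0 x) hgx.le 15).trans (by norm_num)
        have := k3 x
        have e : g x ^ 16 = g x ^ 15 * g x := by ring
        nlinarith [hg0 x]
  have := sum_le_sum (fun x (_ : x ∈ (univ : Finset (ZMod p))) => pt x)
  rw [sum_add_distrib, ← mul_sum] at this
  linarith

noncomputable def wm (u : ZMod p) : ℝ := (ind (u = 1) + ind (u = -1)) / 2
noncomputable def wn (u : ZMod p) : ℝ :=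
  63 / 64 * ind (u = 0) + (ind (u = 1) + ind (u = -1)) / 128

lemma wm_nonneg (u : ZMod p) : 0 ≤ wm u := by
  unfold wm; linarith [ind_nonneg (u = 1), ind_nonneg (u = -1)]
lemma wn_nonneg (u : ZMod p) : 0 ≤ wn u := by
  unfold wn; linarith [ind_nonneg (u = 1), ind_nonneg (u = -1), ind_nonneg (u = 0)]
lemma sum_ind1 {α : Type*} [Fintype α] (a : α) : ∑ u, ind (u = a) = 1 := by
  simpa using sum_ind_eq a (fun _ => 1)
lemma wm_sum : ∑ u : ZMod p, wm u = 1 := by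
  unfold wm; rw [← sum_div, sum_add_distrib, sum_ind1, sum_ind1]; norm_num
lemma wn_sum : ∑ u : ZMod p, wn u = 1 := by
  unfold wn; rw [sum_add_distrib, ← mul_sum, ← sum_div, sum_add_distrib, sum_ind1, sum_ind1, sum_ind1]
  norm_num
lemma one_ne_neg (hp : p ≠ 2) : (1 : ZMod p) ≠ -1 := by
  have : Fact (2 < p) := ⟨lt_of_le_of_ne (Fact.out : p.Prime).two_le hp.symm⟩
  exact (ZMod.neg_one_ne_one).symm
lemma wm_le (hp : p ≠ 2) (u : ZMod p) : wm u ≤ 1 / 2 := by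
  unfold wm
  have : ind (u = 1) + ind (u = -1) ≤ 1 := by
    by_cases h : u = 1
    · rw [ind_pos h, ind_neg (by rw [h]; exact one_ne_neg hp)]; norm_num
    · rw [ind_neg h]; linarith [ind_le_one (u = -1)]
  linarith
lemma wn_le (u : ZMod p) : wn u ≤ 63 / 64 := by
  unfold wn
  by_cases h : u = 0
  · rw [ind_pos h, ind_neg (by rw [h]; exact zero_ne_one),
      ind_neg (by rw [h]; exact (neg_ne_zero.2 one_ne_zero).symm)]; norm_num
  · rw [ind_neg h]; linarith [ind_le_one (u = -1), ind_le_one (u = 1)]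

lemma sum_ind_c {α : Type*} [Fintype α] (a : α) (F : α → ℂ) :
    ∑ u, (ind (u = a) : ℂ) * F u = F a := by
  classical
  simp [ind, apply_ite]

lemma wm_hat (z : ZMod p) : ∑ u : ZMod p, (wm u : ℂ) * ZMod.stdAddChar (z * u) = (ct z : ℂ) := by
  have h : ∀ u : ZMod p, (wm u : ℂ) * ZMod.stdAddChar (z * u) =
    ((ind (u = 1) : ℂ) * ZMod.stdAddChar (z * u) + (ind (u = -1) : ℂ) * ZMod.stdAddChar (z * u)) / 2 := by
    intro u; unfold wm; push_cast; ring
  simp only [h]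
  rw [← sum_div, sum_add_distrib, sum_ind_c 1 (fun u => (ZMod.stdAddChar (z * u) : ℂ)),
    sum_ind_c (-1) (fun u => (ZMod.stdAddChar (z * u) : ℂ))]
  simp only [mul_one, mul_neg, chi_neg]
  push_cast; ring

lemma wn_hat (z : ZMod p) : ∑ u : ZMod p, (wn u : ℂ) * ZMod.stdAddChar (z * u) =
    ((63 / 64 + ct z / 64 : ℝ) : ℂ) := by
  have h : ∀ u : ZMod p, (wn u : ℂ) * ZMod.stdAddChar (z * u) =
    63 / 64 * ((ind (u = 0) : ℂ) * ZMod.stdAddChar (z * u)) +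
    ((ind (u = 1) : ℂ) * ZMod.stdAddChar (z * u) + (ind (u = -1) : ℂ) * ZMod.stdAddChar (z * u)) / 128 := by
    intro u; unfold wn; push_cast; ring
  simp only [h]
  rw [sum_add_distrib, ← mul_sum, ← sum_div, sum_add_distrib,
    sum_ind_c 1 (fun u => (ZMod.stdAddChar (z * u) : ℂ)),
    sum_ind_c 0 (fun u => (ZMod.stdAddChar (z * u) : ℂ)),
    sum_ind_c (-1) (fun u => (ZMod.stdAddChar (z * u) : ℂ))]
  simp only [mul_one, mul_neg, chi_neg, mul_zero, AddChar.map_zero_eq_one]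
  push_cast; ring

noncomputable def wt {n : ℕ} (w : ZMod p → ℝ) (x : Fin n → ZMod p) : ℝ := ∏ i, w (x i)

lemma map_sum_chi {ι : Type*} (S : Finset ι) (F : ι → ZMod p) :
    (ZMod.stdAddChar (∑ i ∈ S, F i) : ℂ) = ∏ i ∈ S, ZMod.stdAddChar (F i) := by
  classical
  induction S using Finset.induction_on with
  | empty => simp
  | insert a s ha ih => rw [sum_insert ha, prod_insert ha, AddChar.map_add_eq_mul, ih]

lemma fourier {n : ℕ} (w φ : ZMod p → ℝ)
    (hw : ∀ z, ∑ u : ZMod p, (w u : ℂ) * ZMod.stdAddChar (z * u) = (φ z : ℂ)) (a : Fin n → ZMod p) :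
    p * ∑ x : Fin n → ZMod p, wt w x * ind (∑ i, a i * x i = 0) = ∑ ξ, ∏ i, φ (ξ * a i) := by
  have e1 : ∀ x : Fin n → ZMod p, ((p * (wt w x * ind (∑ i, a i * x i = 0)) : ℝ) : ℂ) =
      ∑ ξ : ZMod p, ∏ i, ((w (x i) : ℂ) * ZMod.stdAddChar ((ξ * a i) * x i)) := by
    intro x
    have h1 := AddChar.sum_mulShift (∑ i, a i * x i) (ZMod.isPrimitive_stdAddChar p)
    simp only [prod_mul_distrib]
    rw [← mul_sum]
    have h2 : ∀ ξ : ZMod p, ∏ i, (ZMod.stdAddChar ((ξ * a i) * x i) : ℂ) =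
        ZMod.stdAddChar (ξ * ∑ i, a i * x i) := by
      intro ξ
      rw [mul_sum, map_sum_chi]
      simp only [mul_assoc]
    simp only [h2, h1]
    unfold wt ind
    split_ifs <;> simp [mul_comm]
  have e2 : ((p * ∑ x : Fin n → ZMod p, wt w x * ind (∑ i, a i * x i = 0) : ℝ) : ℂ) =
      ((∑ ξ, ∏ i, φ (ξ * a i) : ℝ) : ℂ) := by
    rw [mul_sum, Complex.ofReal_sum]
    simp only [e1]
    rw [sum_comm]
    push_cast
    refine sum_congr rfl (fun ξ _ => ?_)
    simp only [← hw]
    rw [Finset.prod_univ_sum]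
    simp
  exact_mod_cast e2

lemma hyper_compare {n : ℕ} (hp : p ≠ 2) (a : Fin n → ZMod p)
    (hs : ∑ x : Fin n → ZMod p, wt wn x * ind (∑ i, a i * x i = 0) < 0.6) :
    ∑ x : Fin n → ZMod p, wt wm x * ind (∑ i, a i * x i = 0) ≤
    0.87 * ∑ x : Fin n → ZMod p, wt wn x * ind (∑ i, a i * x i = 0) + 0.75 / p := by
  have hp0 : (0:ℝ) < p := by exact_mod_cast (Fact.out : p.Prime).pos
  have f1 := fourier wm ct wm_hat a
  have f2 := fourier wn _ wn_hat a
  have h2 : (2 : ZMod p) ≠ 0 := by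
    intro h
    apply one_ne_neg hp
    rw [eq_neg_iff_add_eq_zero, one_add_one_eq_two, h]
  have f3 : ∑ ξ, ∏ i, (63 / 64 + ct (ξ * a i) / 64) = ∑ ξ, ∏ i, (1 - st (ξ * a i) ^ 2 / 32) := by
    rw [← Equiv.sum_comp (Equiv.mulLeft₀ (2 : ZMod p) h2)]
    refine sum_congr rfl (fun ξ _ => prod_congr rfl (fun i _ => ?_))
    have : (Equiv.mulLeft₀ (2 : ZMod p) h2) ξ * a i = ξ * a i + ξ * a i := by
      simp; ring
    rw [this, ct_add]
    have := cs_sq (ξ * a i)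
    nlinarith
  rw [f3] at f2
  have hg0 : ∀ x : ZMod p, 0 ≤ 1 - st x ^ 2 / 32 := fun x => by linarith [st_sq_le x]
  have hh0 : ∀ x : ZMod p, 0 ≤ 1 - st x ^ 2 / 8 := fun x => by linarith [st_sq_le x]
  have := compare (fun ξ => ∏ i, |ct (ξ * a i)|) (fun ξ => ∏ i, (1 - st (ξ * a i) ^ 2 / 8))
    (fun ξ => ∏ i, (1 - st (ξ * a i) ^ 2 / 32))
    (fun x => prod_nonneg (fun i _ => abs_nonneg _))
    (fun x => prod_le_one (fun i _ => abs_nonneg _) (fun i _ => by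
      nlinarith [abs_ct_le (x * a i), sq_nonneg (st (x * a i))]))
    (fun x => prod_nonneg (fun i _ => hh0 _))
    (fun x => prod_nonneg (fun i _ => hg0 _))
    (fun x => prod_le_one (fun i _ => hg0 _) (fun i _ => by
      nlinarith [sq_nonneg (st (x * a i))]))
    (by simp [ct_zero]) (by simp [st_zero])
    (fun x y => by
      simp only [← prod_mul_distrib, ← prod_pow, add_mul]
      exact prod_le_prod (fun i _ => by positivity) (fun i _ => key1 _ _))
    (fun x y => by
      simp only [← prod_mul_distrib, ← prod_pow, add_mul]
      exact prod_le_prod (fun i _ => mul_nonneg (hh0 _) (hh0 _)) (fun i _ => key2 _ _))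
    (fun x => by
      simp only [← prod_pow]
      exact prod_le_prod (fun i _ => abs_nonneg _) (fun i _ => key3 _))
    (by rw [← f2]; nlinarith)
  have h5 : ∑ ξ, ∏ i, ct (ξ * a i) ≤ ∑ ξ, ∏ i, |ct (ξ * a i)| :=
    sum_le_sum (fun ξ _ => by rw [← abs_prod]; exact le_abs_self _)
  rw [← f1] at h5
  simp only [← f2] at this
  rw [← mul_le_mul_iff_right₀ hp0, mul_add, mul_div_cancel₀ _ hp0.ne']
  linarith

end Fourier
end KKS

namespace KKS
open Finset

section LA
set_option linter.unusedSectionVars false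
variable {p : ℕ} [Fact p.Prime] {n : ℕ}

noncomputable def pr (W : (Fin n → ZMod p) → ℝ) (V : Submodule (ZMod p) (Fin n → ZMod p)) : ℝ :=
  ∑ x, W x * ind (x ∈ V)

lemma wt_nonneg {w : ZMod p → ℝ} (h : ∀ u, 0 ≤ w u) (x : Fin n → ZMod p) : 0 ≤ wt w x :=
  prod_nonneg (fun _ _ => h _)

lemma wt_sum {w : ZMod p → ℝ} (h : ∑ u, w u = 1) : ∑ x : Fin n → ZMod p, wt w x = 1 := by
  have := Finset.prod_univ_sum (fun _ : Fin n => (univ : Finset (ZMod p))) (fun _ u => w u)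
  simp only [h, prod_const_one, Fintype.piFinset_univ] at this
  exact this.symm

lemma odl {w : ZMod p → ℝ} {β : ℝ} (h0 : ∀ u, 0 ≤ w u) (h1 : ∑ u, w u = 1) (hβ : ∀ u, w u ≤ β)
    (V : Submodule (ZMod p) (Fin n → ZMod p)) :
    pr (wt w) V ≤ β ^ (n - Module.finrank (ZMod p) V) := by
  classical
  obtain ⟨κ, a, ha, hspan, hli⟩ := exists_linearIndependent' (ZMod p)
    (fun i : Fin n => V.mkQ (Pi.single i 1))
  have : Fintype κ := Fintype.ofInjective a ha
  have htop : Submodule.span (ZMod p) (Set.range fun i : Fin n => V.mkQ (Pi.single i (1 : ZMod p))) = ⊤ := by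
    have e : (Set.range fun i : Fin n => V.mkQ (Pi.single i (1 : ZMod p))) =
      V.mkQ '' (Set.range fun i : Fin n => (Pi.single i (1 : ZMod p) : Fin n → ZMod p)) := by
      rw [← Set.range_comp]; rfl
    have e2 : (Set.range fun i : Fin n => (Pi.single i (1 : ZMod p) : Fin n → ZMod p)) =
      Set.range (Pi.basisFun (ZMod p) (Fin n)) := by
      congr 1; ext i; simp
    rw [e, ← Submodule.map_span, e2, Module.Basis.span_eq, Submodule.map_top, Submodule.range_mkQ]
  rw [htop] at hspan
  have hcard : Fintype.card κ = n - Module.finrank (ZMod p) V := by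
    have h := finrank_span_eq_card hli
    rw [hspan, finrank_top] at h
    have h2 := Submodule.finrank_quotient_add_finrank V
    simp at h2
    omega
  set I : Finset (Fin n) := univ.image a with hI
  have hIc : #I = n - Module.finrank (ZMod p) V := by
    rw [hI, card_image_of_injective _ ha, Finset.card_univ, hcard]
  have hβ0 : 0 ≤ β := (h0 0).trans (hβ 0)
  rw [← hIc]
  have s1 : pr (wt w) V = ∑ x ∈ univ.filter (fun x => x ∈ V), wt w x := by
    rw [sum_filter]
    refine sum_congr rfl (fun x _ => ?_)
    by_cases h : x ∈ V <;> simp [ind, h]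
  have inj : Set.InjOn (fun (x : Fin n → ZMod p) (i : {i // i ∉ I}) => x i)
      (univ.filter (fun x => x ∈ V) : Finset (Fin n → ZMod p)) := by
    intro x hx y hy hxy
    simp only [coe_filter, mem_univ, true_and, Set.mem_ofPred_eq] at hx hy
    have hz : x - y ∈ V := V.sub_mem hx hy
    have hz0 : ∀ i, i ∉ I → (x - y) i = 0 := by
      intro i hi
      have := congrFun hxy ⟨i, hi⟩
      simp only at this
      simp [this]
    have hq : V.mkQ (x - y) = 0 := (Submodule.Quotient.mk_eq_zero V).2 hz
    have hexp : x - y = ∑ k : κ, (x - y) (a k) • (Pi.single (a k) (1 : ZMod p) : Fin n → ZMod p) := by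
      rw [pi_eq_sum_univ' (x - y)]
      have : ∑ k : κ, (x - y) (a k) • (Pi.single (a k) (1 : ZMod p) : Fin n → ZMod p) =
        ∑ i ∈ I, (x - y) i • (Pi.single i (1 : ZMod p) : Fin n → ZMod p) := by
        rw [hI, sum_image (fun _ _ _ _ h => ha h)]
      rw [← pi_eq_sum_univ' (x - y), this]
      conv_lhs => rw [pi_eq_sum_univ' (x - y)]
      symm
      refine (sum_subset (subset_univ I) ?_).trans ?_
      · intro i _ hi; rw [hz0 i hi, zero_smul]
      · exact sum_congr rfl (fun i _ => by simp)
    rw [hexp, map_sum] at hq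
    simp only [map_smul] at hq
    have hc := Fintype.linearIndependent_iff.1 hli (fun k => (x - y) (a k)) hq
    have : x - y = 0 := by
      ext i
      by_cases hi : i ∈ I
      · rw [hI, mem_image] at hi
        obtain ⟨k, _, rfl⟩ := hi
        exact hc k
      · exact hz0 i hi
    exact sub_eq_zero.1 this
  have s2 : ∀ x : Fin n → ZMod p, wt w x ≤ β ^ #I * ∏ i : {i // i ∉ I}, w (x i) := by
    intro x
    unfold wt
    rw [← Fintype.prod_subtype_mul_prod_subtype (fun i => i ∈ I)]
    refine mul_le_mul_of_nonneg_right ?_ (prod_nonneg fun _ _ => h0 _)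
    refine (prod_le_prod (fun _ _ => h0 _) (fun _ _ => hβ _)).trans ?_
    simp
  rw [s1]
  refine (sum_le_sum (fun x _ => s2 x)).trans ?_
  rw [← mul_sum]
  refine mul_le_of_le_one_right (pow_nonneg hβ0 _) ?_
  have s3 := sum_image (f := fun z : {i // i ∉ I} → ZMod p => ∏ i, w (z i)) inj
  rw [← s3]
  refine (sum_le_sum_of_subset_of_nonneg (subset_univ _)
    (fun z _ _ => prod_nonneg fun _ _ => h0 _)).trans ?_
  have := Finset.prod_univ_sum (fun _ : {i // i ∉ I} => (univ : Finset (ZMod p))) (fun _ u => w u)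
  simp only [h1, prod_const_one, Fintype.piFinset_univ] at this
  exact this.symm.le

variable {W : (Fin n → ZMod p) → ℝ}

lemma pr_nonneg (h0 : ∀ x, 0 ≤ W x) (V : Submodule (ZMod p) (Fin n → ZMod p)) : 0 ≤ pr W V :=
  sum_nonneg (fun x _ => mul_nonneg (h0 x) (ind_nonneg _))

lemma pr_mono (h0 : ∀ x, 0 ≤ W x) {V U : Submodule (ZMod p) (Fin n → ZMod p)} (h : V ≤ U) :
    pr W V ≤ pr W U :=
  sum_le_sum (fun x _ => mul_le_mul_of_nonneg_left (ind_mono (fun hx => h hx)) (h0 x))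

lemma pr_top (h1 : ∑ x, W x = 1) : pr W ⊤ = 1 := by
  unfold pr; rw [← h1]; exact sum_congr rfl (fun x _ => by rw [ind_pos (by simp), mul_one])

lemma pr_le_one (h0 : ∀ x, 0 ≤ W x) (h1 : ∑ x, W x = 1)
    (V : Submodule (ZMod p) (Fin n → ZMod p)) : pr W V ≤ 1 :=
  (pr_mono h0 le_top).trans (pr_top h1).le

/-- product weight of a sequence -/
noncomputable def pw {ι : Type*} [Fintype ι] (W : (Fin n → ZMod p) → ℝ)
    (v : ι → Fin n → ZMod p) : ℝ := ∏ j, W (v j)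

lemma pw_nonneg {ι : Type*} [Fintype ι] (h0 : ∀ x, 0 ≤ W x) (v : ι → Fin n → ZMod p) : 0 ≤ pw W v :=
  prod_nonneg (fun _ _ => h0 _)

lemma pw_sum {ι : Type*} [Fintype ι] [DecidableEq ι] (h1 : ∑ x, W x = 1) : ∑ v : ι → Fin n → ZMod p, pw W v = 1 := by
  classical
  have := Finset.prod_univ_sum (fun _ : ι => (univ : Finset (Fin n → ZMod p))) (fun _ u => W u)
  simp only [h1, prod_const_one, Fintype.piFinset_univ] at this
  exact this.symm

lemma pw_cons {i : ℕ} (x : Fin n → ZMod p) (v : Fin i → Fin n → ZMod p) :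
    pw W (Fin.cons x v : Fin (i+1) → Fin n → ZMod p) = W x * pw W v := by
  simp [pw, Fin.prod_univ_succ]

lemma sum_cons {i : ℕ} (G : (Fin (i+1) → Fin n → ZMod p) → ℝ) :
    ∑ v, G v = ∑ v : Fin i → Fin n → ZMod p, ∑ x, G (Fin.cons x v) := by
  rw [← Equiv.sum_comp (Fin.consEquiv (fun _ : Fin (i+1) => Fin n → ZMod p)),
    Fintype.sum_prod_type, sum_comm]
  rfl

abbrev sp {ι : Type*} (v : ι → Fin n → ZMod p) : Submodule (ZMod p) (Fin n → ZMod p) :=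
  Submodule.span (ZMod p) (Set.range v)

noncomputable def bs (W : (Fin n → ZMod p) → ℝ) (V : Submodule (ZMod p) (Fin n → ZMod p)) (i : ℕ) : ℝ :=
  ∑ v : Fin i → Fin n → ZMod p, pw W v * ind (LinearIndependent (ZMod p) v ∧ ∀ j, v j ∈ V)

noncomputable def dd (W : (Fin n → ZMod p) → ℝ) (i : ℕ) : ℝ :=
  ∑ v : Fin i → Fin n → ZMod p, pw W v * ind (LinearIndependent (ZMod p) v) * pr W (sp v)

lemma bs_nonneg (h0 : ∀ x, 0 ≤ W x) (V : Submodule (ZMod p) (Fin n → ZMod p)) (i : ℕ) :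
    0 ≤ bs W V i := sum_nonneg (fun _ _ => mul_nonneg (pw_nonneg h0 _) (ind_nonneg _))

lemma dd_nonneg (h0 : ∀ x, 0 ≤ W x) (i : ℕ) : 0 ≤ dd W i :=
  sum_nonneg (fun _ _ => mul_nonneg (mul_nonneg (pw_nonneg h0 _) (ind_nonneg _)) (pr_nonneg h0 _))

lemma bs_zero (V : Submodule (ZMod p) (Fin n → ZMod p)) : bs W V 0 = 1 := by
  unfold bs
  rw [Fintype.sum_unique]
  rw [ind_pos ⟨linearIndependent_empty_type, fun j => j.elim0⟩]
  simp [pw]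

lemma bs_succ (V : Submodule (ZMod p) (Fin n → ZMod p)) (i : ℕ) :
    bs W V (i+1) = ∑ v : Fin i → Fin n → ZMod p,
      pw W v * ind (LinearIndependent (ZMod p) v ∧ ∀ j, v j ∈ V) * (pr W V - pr W (sp v)) := by
  unfold bs
  rw [sum_cons]
  refine sum_congr rfl (fun v _ => ?_)
  by_cases h : LinearIndependent (ZMod p) v ∧ ∀ j, v j ∈ V
  · have hle : sp v ≤ V := by
      rw [Submodule.span_le]; rintro _ ⟨j, rfl⟩; exact h.2 j
    rw [ind_pos h, mul_one]
    unfold pr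
    rw [← sum_sub_distrib, mul_sum]
    refine sum_congr rfl (fun x _ => ?_)
    rw [pw_cons, linearIndependent_finCons]
    have e : ind ((LinearIndependent (ZMod p) v ∧ x ∉ Submodule.span (ZMod p) (Set.range v)) ∧
        ∀ j, (Fin.cons x v : Fin (i+1) → Fin n → ZMod p) j ∈ V) = ind (x ∈ V) - ind (x ∈ sp v) := by
      by_cases hx : x ∈ sp v
      · rw [ind_pos hx, ind_pos (hle hx), ind_neg (fun h => h.1.2 hx)]; ring
      · rw [ind_neg hx, sub_zero]
        refine ind_congr ⟨fun h => h.2 0, fun h' => ⟨⟨h.1, hx⟩, fun j => ?_⟩⟩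
        refine Fin.cases ?_ ?_ j
        · simpa using h'
        · intro j; simpa using h.2 j
    rw [e]; ring
  · rw [ind_neg h, mul_zero, zero_mul]
    refine sum_eq_zero (fun x _ => ?_)
    rw [ind_neg, mul_zero]
    rintro ⟨h1, h2⟩
    rw [linearIndependent_finCons] at h1
    exact h ⟨h1.1, fun j => by simpa using h2 j.succ⟩

lemma bs_lower {β : ℝ} (h0 : ∀ x, 0 ≤ W x)
    (hO : ∀ V, pr W V ≤ β ^ (n - Module.finrank (ZMod p) V))
    (V : Submodule (ZMod p) (Fin n → ZMod p)) (i : ℕ) :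
    bs W V i * (pr W V - β ^ (n - i)) ≤ bs W V (i+1) := by
  rw [bs_succ]
  unfold bs
  rw [sum_mul]
  refine sum_le_sum (fun v _ => ?_)
  by_cases h : LinearIndependent (ZMod p) v ∧ ∀ j, v j ∈ V
  · refine mul_le_mul_of_nonneg_left ?_ (mul_nonneg (pw_nonneg h0 _) (ind_nonneg _))
    have := hO (sp v)
    rw [finrank_span_eq_card h.1, Fintype.card_fin] at this
    linarith
  · rw [ind_neg h]; simp

lemma s_succ (h1 : ∑ x, W x = 1) (i : ℕ) : bs W ⊤ (i+1) = bs W ⊤ i - dd W i := by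
  rw [bs_succ]
  unfold bs dd
  rw [← sum_sub_distrib]
  refine sum_congr rfl (fun v _ => ?_)
  rw [pr_top h1]
  have : ind (LinearIndependent (ZMod p) v ∧ ∀ j, v j ∈ (⊤ : Submodule (ZMod p) (Fin n → ZMod p))) =
    ind (LinearIndependent (ZMod p) v) := ind_congr (by simp)
  rw [this]; ring

lemma dd_succ {β : ℝ} (h0 : ∀ x, 0 ≤ W x) (h1 : ∑ x, W x = 1)
    (hO : ∀ V, pr W V ≤ β ^ (n - Module.finrank (ZMod p) V)) (i : ℕ) :
    dd W i * (1 - β ^ (n - i)) ≤ dd W (i+1) := by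
  unfold dd
  rw [sum_cons, sum_mul]
  refine sum_le_sum (fun v _ => ?_)
  by_cases h : LinearIndependent (ZMod p) v
  · have hb := hO (sp v)
    rw [finrank_span_eq_card h, Fintype.card_fin] at hb
    have hn := pr_nonneg h0 (sp v)
    have hw := pw_nonneg h0 v
    calc pw W v * ind (LinearIndependent (ZMod p) v) * pr W (sp v) * (1 - β ^ (n - i))
        ≤ pw W v * ind (LinearIndependent (ZMod p) v) * pr W (sp v) * (1 - pr W (sp v)) := by
          refine mul_le_mul_of_nonneg_left (by linarith) ?_
          exact mul_nonneg (mul_nonneg hw (ind_nonneg _)) hn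
      _ = ∑ x, pw W v * pr W (sp v) * (W x - W x * ind (x ∈ sp v)) := by
          rw [← mul_sum, sum_sub_distrib, h1, ind_pos h]; unfold pr; ring
      _ ≤ _ := by
          refine sum_le_sum (fun x _ => ?_)
          rw [pw_cons, linearIndependent_finCons]
          by_cases hx : x ∈ sp v
          · rw [ind_pos hx]
            simp only [mul_one, sub_self, mul_zero]
            exact mul_nonneg (mul_nonneg (mul_nonneg (h0 x) hw) (ind_nonneg _)) (pr_nonneg h0 _)
          · rw [ind_neg hx, ind_pos ⟨h, hx⟩]
            have : pr W (sp v) ≤ pr W (sp (Fin.cons x v : Fin (i+1) → Fin n → ZMod p)) := by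
              apply pr_mono h0
              apply Submodule.span_mono
              rintro _ ⟨j, rfl⟩
              exact ⟨j.succ, by simp⟩
            have := mul_le_mul_of_nonneg_left this (mul_nonneg (h0 x) hw)
            linarith
  · rw [ind_neg h]
    simp only [mul_zero, zero_mul]
    exact sum_nonneg (fun x _ => mul_nonneg (mul_nonneg (pw_nonneg h0 _) (ind_nonneg _)) (pr_nonneg h0 _))

lemma dd_last (h0 : ∀ x, 0 ≤ W x) (h1 : ∑ x, W x = 1)
    (hO : ∀ V, pr W V ≤ (1/2 : ℝ) ^ (n - Module.finrank (ZMod p) V)) (j : ℕ) (hj : j + 1 ≤ n) :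
    dd W (n - 1 - j) * (1/2 + (1/2 : ℝ) ^ (j + 1)) ≤ dd W (n - 1) := by
  induction j with
  | zero => simp; apply le_of_eq; ring
  | succ j ih =>
    have ih := ih (by omega)
    have h := dd_succ h0 h1 hO (n - 1 - (j+1))
    have e1 : n - 1 - (j + 1) + 1 = n - 1 - j := by omega
    have e2 : n - (n - 1 - (j + 1)) = j + 2 := by omega
    rw [e1, e2] at h
    have hd := dd_nonneg h0 (n - 1 - (j+1))
    set y := (1/2 : ℝ) ^ j with hy
    have hy0 : 0 < y := by positivity
    have hy1 : y ≤ 1 := pow_le_one₀ (by norm_num) (by norm_num)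
    have p1 : (1/2 : ℝ) ^ (j + 1) = y / 2 := by rw [pow_succ]; ring
    have p2 : (1/2 : ℝ) ^ (j + 2) = y / 4 := by rw [pow_add, ← hy]; ring
    have p3 : (1/2 : ℝ) ^ (j + 1 + 1) = y / 4 := p2
    rw [p1] at ih
    rw [p2] at h
    rw [p3]
    calc dd W (n - 1 - (j + 1)) * (1 / 2 + y / 4)
        ≤ dd W (n - 1 - (j + 1)) * ((1 - y / 4) * (1 / 2 + y / 2)) := by
          refine mul_le_mul_of_nonneg_left ?_ hd
          nlinarith
      _ = dd W (n - 1 - (j + 1)) * (1 - y / 4) * (1 / 2 + y / 2) := by ring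
      _ ≤ dd W (n - 1 - j) * (1 / 2 + y / 2) := mul_le_mul_of_nonneg_right h (by positivity)
      _ ≤ _ := ih

lemma s_lower (h0 : ∀ x, 0 ≤ W x) (h1 : ∑ x, W x = 1)
    (hO : ∀ V, pr W V ≤ (1/2 : ℝ) ^ (n - Module.finrank (ZMod p) V)) :
    1 - bs W ⊤ n ≤ 2 * n * dd W (n - 1) := by
  have key : ∀ i, i ≤ n → 1 - bs W ⊤ i ≤ 2 * i * dd W (n - 1) := by
    intro i
    induction i with
    | zero => intro _; rw [bs_zero]; simp
    | succ i ih =>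
      intro hi
      have ih := ih (by omega)
      rw [s_succ h1]
      have := dd_last h0 h1 hO (n - 1 - i) (by omega)
      have e : n - 1 - (n - 1 - i) = i := by omega
      rw [e] at this
      have hp : 0 ≤ (1/2 : ℝ) ^ (n - 1 - i + 1) := by positivity
      have := mul_nonneg (dd_nonneg h0 i) hp
      push_cast
      nlinarith
  exact key n le_rfl

lemma s_pos (h0 : ∀ x, 0 ≤ W x) (h1 : ∑ x, W x = 1)
    (hO : ∀ V, pr W V ≤ (1/2 : ℝ) ^ (n - Module.finrank (ZMod p) V)) :
    0 < bs W ⊤ n := by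
  have key : ∀ i, i ≤ n → 0 < bs W ⊤ i := by
    intro i
    induction i with
    | zero => intro _; rw [bs_zero]; norm_num
    | succ i ih =>
      intro hi
      have ih := ih (by omega)
      refine lt_of_lt_of_le (mul_pos ih ?_) (bs_lower h0 hO ⊤ i)
      rw [pr_top h1]
      have : (1/2 : ℝ) ^ (n - i) < 1 := pow_lt_one₀ (by norm_num) (by norm_num) (by omega)
      linarith
  exact key n le_rfl

lemma bs_pow {β ε : ℝ} (hβ0 : 0 ≤ β) (hβ1 : β ≤ 1) (h0 : ∀ x, 0 ≤ W x)
    (hO : ∀ V, pr W V ≤ β ^ (n - Module.finrank (ZMod p) V))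
    (V : Submodule (ZMod p) (Fin n → ZMod p)) (m : ℕ) (hV : β ^ (n - m) ≤ ε * pr W V) (hε : ε ≤ 1) :
    ((1 - ε) * pr W V) ^ m ≤ bs W V m := by
  have hc : 0 ≤ (1 - ε) * pr W V := mul_nonneg (by linarith) (pr_nonneg h0 V)
  have key : ∀ i, i ≤ m → ((1 - ε) * pr W V) ^ i ≤ bs W V i := by
    intro i
    induction i with
    | zero => intro _; rw [bs_zero]; simp
    | succ i ih =>
      intro hi
      have ih := ih (by omega)
      refine le_trans ?_ (bs_lower h0 hO V i)
      rw [pow_succ]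
      refine mul_le_mul ih ?_ hc (bs_nonneg h0 V i)
      have : β ^ (n - i) ≤ β ^ (n - m) := pow_le_pow_of_le_one hβ0 hβ1 (by omega)
      linarith
  exact key m le_rfl
end LA
end KKS

namespace KKS
open Finset

section Exch
set_option linter.unusedSectionVars false
variable {p : ℕ} [Fact p.Prime] {n : ℕ}

lemma exch {m N : ℕ} (y : Fin m → Fin n → ZMod p) (v : Fin N → Fin n → ZMod p)
    (V : Submodule (ZMod p) (Fin n → ZMod p))
    (hy : LinearIndependent (ZMod p) y) (hv : LinearIndependent (ZMod p) v) (hV : sp v = V)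
    (hyV : ∀ j, y j ∈ V) :
    ∃ T ∈ powersetCard (N - m) (univ : Finset (Fin N)),
      sp (Sum.elim y (fun j : {j // j ∈ T} => v j)) = V ∧ ∀ j : {j // j ∉ T}, v j ∈ V := by
  classical
  set f : Fin m ⊕ Fin N → Fin n → ZMod p := Sum.elim y v with hf
  have hs : LinearIndepOn (ZMod p) f (Set.range Sum.inl) := by
    rw [linearIndepOn_range_iff Sum.inl_injective]
    simpa [hf] using hy
  obtain ⟨b, -, hsb, hsp, hli⟩ := exists_linearIndepOn_extension hs (Set.subset_univ _)
  have hvV : ∀ j, v j ∈ V := fun j => hV ▸ Submodule.subset_span ⟨j, rfl⟩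
  have hfV : ∀ j, f j ∈ V := by
    rintro (j | j)
    · exact hyV j
    · exact hvV j
  have hspan : Submodule.span (ZMod p) (f '' b) = V := by
    apply le_antisymm
    · rw [Submodule.span_le]; rintro _ ⟨j, _, rfl⟩; exact hfV j
    · rw [← hV, Submodule.span_le]
      rintro _ ⟨j, rfl⟩
      exact hsp ⟨Sum.inr j, trivial, rfl⟩
  let T : Finset (Fin N) := univ.filter (fun j => Sum.inr j ∈ b)
  have hB : b.toFinset = univ.disjSum T := by
    ext (j | j)
    · simp; exact hsb ⟨j, rfl⟩
    · simp [T]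
  have hcard : Fintype.card b = N := by
    have h1 := finrank_span_eq_card hli
    have e : Set.range (fun x : b => f x) = f '' b := by
      ext; simp
    rw [e, hspan, ← hV, finrank_span_eq_card hv] at h1
    simpa using h1.symm
  have hT : #T = N - m := by
    rw [← Set.toFinset_card, hB, card_disjSum] at hcard
    simp at hcard
    omega
  refine ⟨T, ?_, ?_, fun j => hvV j⟩
  · rw [mem_powersetCard]; exact ⟨subset_univ _, hT⟩
  · rw [← hspan]
    unfold sp
    congr 1
    ext x
    constructor
    · rintro ⟨j | j, rfl⟩
      · exact ⟨Sum.inl j, hsb ⟨j, rfl⟩, rfl⟩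
      · exact ⟨Sum.inr j, (mem_filter.1 j.2).2, rfl⟩
    · rintro ⟨j | j, hj, rfl⟩
      · exact ⟨Sum.inl j, rfl⟩
      · exact ⟨Sum.inr ⟨j, by simpa [T] using hj⟩, rfl⟩

lemma prod_ind {ι : Type*} [Fintype ι] (P : ι → Prop) : ∏ i, ind (P i) = ind (∀ i, P i) := by
  by_cases h : ∀ i, P i
  · rw [ind_pos h]; exact prod_eq_one (fun i _ => ind_pos (h i))
  · rw [ind_neg h]
    push Not at h
    obtain ⟨i, hi⟩ := h
    exact prod_eq_zero (mem_univ i) (ind_neg hi)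

variable {A B : (Fin n → ZMod p) → ℝ}

lemma pr_pow {ι : Type*} [Fintype ι] [DecidableEq ι] (V : Submodule (ZMod p) (Fin n → ZMod p)) :
    ∑ z : ι → Fin n → ZMod p, pw A z * ind (∀ j, z j ∈ V) = pr A V ^ Fintype.card ι := by
  have := Finset.prod_univ_sum (fun _ : ι => (univ : Finset (Fin n → ZMod p)))
    (fun _ u => A u * ind (u ∈ V))
  simp only [prod_const, Fintype.piFinset_univ, Finset.card_univ] at this
  unfold pr
  rw [this]
  refine sum_congr rfl (fun z _ => ?_)
  rw [prod_mul_distrib, prod_ind]; rfl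

noncomputable def gam (A B : (Fin n → ZMod p) → ℝ) {N : ℕ} (m : ℕ) (T : Finset (Fin N))
    (V : Submodule (ZMod p) (Fin n → ZMod p)) : ℝ :=
  ∑ z : {j // j ∈ T} → Fin n → ZMod p, ∑ y : Fin m → Fin n → ZMod p,
    pw A z * pw B y * ind (sp (Sum.elim y z) = V)

lemma split_T {m N : ℕ} (T : Finset (Fin N)) (V : Submodule (ZMod p) (Fin n → ZMod p)) :
    ∑ v : Fin N → Fin n → ZMod p, ∑ y : Fin m → Fin n → ZMod p,
      pw A v * pw B y * (ind (sp (Sum.elim y (fun j : {j // j ∈ T} => v j)) = V) *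
        ind (∀ j : {j // j ∉ T}, v j ∈ V)) = gam A B m T V * pr A V ^ (N - #T) := by
  have hc : Fintype.card {j // j ∉ T} = N - #T := by
    rw [Fintype.card_subtype_compl]; simp
  rw [← hc, ← pr_pow, gam, sum_mul_sum,
    ← Equiv.sum_comp (Equiv.piEquivPiSubtypeProd (fun j => j ∈ T) (fun _ => Fin n → ZMod p)).symm,
    Fintype.sum_prod_type]
  refine sum_congr rfl (fun z _ => sum_congr rfl (fun z' _ => ?_))
  rw [sum_mul]
  refine sum_congr rfl (fun y _ => ?_)
  set v := (Equiv.piEquivPiSubtypeProd (fun j => j ∈ T) (fun _ => Fin n → ZMod p)).symm (z, z') with hv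
  have e1 : ∀ j : {j // j ∈ T}, v j = z j := by
    intro j; simp [hv, Equiv.piEquivPiSubtypeProd]
  have e2 : ∀ j : {j // j ∉ T}, v j = z' j := by
    intro j; simp [hv, Equiv.piEquivPiSubtypeProd, j.2]
  have e3 : pw A v = pw A z * pw A z' := by
    unfold pw
    rw [← Fintype.prod_subtype_mul_prod_subtype (fun j => j ∈ T)]
    simp only [e1, e2]
    congr!
  simp only [e1, e2, e3]
  ring

lemma gam_sum (hA0 : ∀ x, 0 ≤ A x) (hA : ∑ x, A x = 1) (hB0 : ∀ x, 0 ≤ B x) (hB : ∑ x, B x = 1)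
    {m N : ℕ} (T : Finset (Fin N))
    (G : Finset (Submodule (ZMod p) (Fin n → ZMod p))) : ∑ V ∈ G, gam A B m T V ≤ 1 := by
  classical
  unfold gam
  rw [sum_comm]
  have h : ∑ z : {j // j ∈ T} → Fin n → ZMod p, ∑ y : Fin m → Fin n → ZMod p, pw A z * pw B y = 1 := by
    rw [← sum_mul_sum, pw_sum hA, pw_sum hB, one_mul]
  rw [← h]
  refine sum_le_sum (fun z _ => ?_)
  rw [sum_comm]
  refine sum_le_sum (fun y _ => ?_)
  rw [← mul_sum]
  refine mul_le_of_le_one_right (mul_nonneg (pw_nonneg hA0 _) (pw_nonneg hB0 _)) ?_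
  by_cases hG : sp (Sum.elim y z) ∈ G
  · rw [sum_eq_single_of_mem _ hG (fun V _ hV => ind_neg (fun h => hV h.symm))]
    exact ind_le_one _
  · have h0 : ∑ V ∈ G, ind (sp (Sum.elim y z) = V) = 0 :=
      sum_eq_zero (fun V hV => ind_neg (fun h => hG (by rw [h]; exact hV)))
    rw [h0]; norm_num

lemma gam_nonneg (hA0 : ∀ x, 0 ≤ A x) (hB0 : ∀ x, 0 ≤ B x)
    {m N : ℕ} (T : Finset (Fin N)) (V : Submodule (ZMod p) (Fin n → ZMod p)) : 0 ≤ gam A B m T V :=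
  sum_nonneg (fun _ _ => sum_nonneg (fun _ _ =>
    mul_nonneg (mul_nonneg (pw_nonneg hA0 _) (pw_nonneg hB0 _)) (ind_nonneg _)))

noncomputable def alp (A : (Fin n → ZMod p) → ℝ) (N : ℕ) (V : Submodule (ZMod p) (Fin n → ZMod p)) : ℝ :=
  ∑ v : Fin N → Fin n → ZMod p, pw A v * ind (LinearIndependent (ZMod p) v ∧ sp v = V)

lemma alp_bs (hA0 : ∀ x, 0 ≤ A x) (hB0 : ∀ x, 0 ≤ B x) {m N : ℕ} (hm : m ≤ N)
    (V : Submodule (ZMod p) (Fin n → ZMod p)) :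
    alp A N V * bs B V m ≤
      (∑ T ∈ powersetCard (N - m) (univ : Finset (Fin N)), gam A B m T V) * pr A V ^ m := by
  have e : (∑ T ∈ powersetCard (N - m) (univ : Finset (Fin N)), gam A B m T V) * pr A V ^ m =
    ∑ T ∈ powersetCard (N - m) (univ : Finset (Fin N)),
      ∑ v : Fin N → Fin n → ZMod p, ∑ y : Fin m → Fin n → ZMod p,
      pw A v * pw B y * (ind (sp (Sum.elim y (fun j : {j // j ∈ T} => v j)) = V) *
        ind (∀ j : {j // j ∉ T}, v j ∈ V)) := by
    rw [sum_mul]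
    refine sum_congr rfl (fun T hT => ?_)
    rw [split_T]
    have := (mem_powersetCard.1 hT).2
    congr 2; omega
  rw [e, sum_comm]
  unfold alp bs
  rw [sum_mul_sum]
  refine sum_le_sum (fun v _ => ?_)
  rw [sum_comm]
  refine sum_le_sum (fun y _ => ?_)
  rw [← mul_sum]
  have hn : 0 ≤ pw A v * pw B y := mul_nonneg (pw_nonneg hA0 _) (pw_nonneg hB0 _)
  have : pw A v * ind (LinearIndependent (ZMod p) v ∧ sp v = V) *
    (pw B y * ind (LinearIndependent (ZMod p) y ∧ ∀ j, y j ∈ V)) = pw A v * pw B y *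
    ind ((LinearIndependent (ZMod p) v ∧ sp v = V) ∧ (LinearIndependent (ZMod p) y ∧ ∀ j, y j ∈ V)) := by
    rw [ind_and (LinearIndependent (ZMod p) v ∧ sp v = V)]; ring
  rw [this]
  refine mul_le_mul_of_nonneg_left ?_ hn
  have hnn : ∀ T ∈ powersetCard (N - m) (univ : Finset (Fin N)),
      0 ≤ ind (sp (Sum.elim y (fun j : {j // j ∈ T} => v j)) = V) *
        ind (∀ j : {j // j ∉ T}, v j ∈ V) := fun T _ => mul_nonneg (ind_nonneg _) (ind_nonneg _)
  by_cases h : (LinearIndependent (ZMod p) v ∧ sp v = V) ∧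
      (LinearIndependent (ZMod p) y ∧ ∀ j, y j ∈ V)
  · obtain ⟨T, hT, h1, h2⟩ := exch y v V h.2.1 h.1.1 h.1.2 h.2.2
    refine le_trans ?_ (single_le_sum hnn hT)
    rw [ind_pos h, ind_pos h1, ind_pos h2]; norm_num
  · rw [ind_neg h]; exact sum_nonneg hnn

lemma dd_bound (hA0 : ∀ x, 0 ≤ A x) (hA : ∑ x, A x = 1) (hB0 : ∀ x, 0 ≤ B x) (hB : ∑ x, B x = 1)
    {m N : ℕ} (hm : m ≤ N) {τ R : ℝ} (hτ : 0 ≤ τ) (hR : 0 ≤ R)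
    (hgood : ∀ V : Submodule (ZMod p) (Fin n → ZMod p), Module.finrank (ZMod p) V = N → τ ≤ pr A V →
      0 < bs B V m ∧ pr A V ^ m ≤ R * bs B V m) :
    dd A N ≤ τ + R * N.choose (N - m) := by
  classical
  let : Fintype (Submodule (ZMod p) (Fin n → ZMod p)) := Fintype.ofFinite _
  let G : Finset (Submodule (ZMod p) (Fin n → ZMod p)) :=
    univ.filter (fun V => Module.finrank (ZMod p) V = N ∧ τ ≤ pr A V)
  have s1 : dd A N ≤ τ + ∑ V ∈ G, alp A N V := by
    have e : ∑ V ∈ G, alp A N V = ∑ v : Fin N → Fin n → ZMod p, pw A v *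
        ∑ V ∈ G, ind (LinearIndependent (ZMod p) v ∧ sp v = V) := by
      unfold alp
      rw [sum_comm]
      simp only [mul_sum]
    have e2 : τ = ∑ v : Fin N → Fin n → ZMod p, pw A v * τ := by
      rw [← sum_mul, pw_sum hA, one_mul]
    rw [e]
    conv_rhs => rw [e2]
    rw [← sum_add_distrib]
    unfold dd
    refine sum_le_sum (fun v _ => ?_)
    rw [mul_assoc, ← mul_add]
    refine mul_le_mul_of_nonneg_left ?_ (pw_nonneg hA0 _)
    have hnn : ∀ V ∈ G, 0 ≤ ind (LinearIndependent (ZMod p) v ∧ sp v = V) := fun _ _ => ind_nonneg _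
    by_cases hl : LinearIndependent (ZMod p) v
    · rw [ind_pos hl, one_mul]
      by_cases hg : τ ≤ pr A (sp v)
      · have hm : sp v ∈ G := by
          simp only [G, mem_filter, mem_univ, true_and]
          exact ⟨by rw [finrank_span_eq_card hl, Fintype.card_fin], hg⟩
        have := single_le_sum hnn hm
        rw [ind_pos ⟨hl, rfl⟩] at this
        linarith [pr_le_one hA0 hA (sp v)]
      · linarith [sum_nonneg hnn]
    · rw [ind_neg hl]; linarith [sum_nonneg hnn]
  have s2 : ∀ V ∈ G, alp A N V ≤
      R * ∑ T ∈ powersetCard (N - m) (univ : Finset (Fin N)), gam A B m T V := by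
    intro V hV
    simp only [G, mem_filter, mem_univ, true_and] at hV
    obtain ⟨hb, hle⟩ := hgood V hV.1 hV.2
    have h1 := alp_bs hA0 hB0 hm V
    have hg : 0 ≤ ∑ T ∈ powersetCard (N - m) (univ : Finset (Fin N)), gam A B m T V :=
      sum_nonneg (fun T _ => gam_nonneg hA0 hB0 T V)
    have h2 := mul_le_mul_of_nonneg_left hle hg
    have h3 := h1.trans h2
    refine le_of_mul_le_mul_right ?_ hb
    linarith
  refine s1.trans (add_le_add_right ((sum_le_sum s2).trans ?_) τ)
  rw [← mul_sum, sum_comm]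
  refine mul_le_mul_of_nonneg_left ?_ hR
  refine (sum_le_sum (fun T _ => gam_sum hA0 hA hB0 hB T G)).trans ?_
  simp

lemma hyper (V : Submodule (ZMod p) (Fin n → ZMod p)) (hn : 0 < n)
    (hV : Module.finrank (ZMod p) V = n - 1) :
    ∃ a : Fin n → ZMod p, ∀ x, x ∈ V ↔ ∑ i, a i * x i = 0 := by
  have hlt : V < ⊤ := by
    rw [lt_top_iff_ne_top]
    rintro rfl
    rw [finrank_top] at hV
    simp at hV; omega
  obtain ⟨f, hf0, hf⟩ := Submodule.exists_le_ker_of_lt_top V hlt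
  have hk : V = LinearMap.ker f := by
    apply Submodule.eq_of_le_of_finrank_eq hf
    have h1 := LinearMap.finrank_range_add_finrank_ker f
    have h2 : LinearMap.range f = ⊤ := LinearMap.range_eq_top.2 (LinearMap.surjective hf0)
    rw [h2, finrank_top] at h1
    simp at h1
    omega
  refine ⟨fun i => f (fun j => if i = j then 1 else 0), fun x => ?_⟩
  rw [hk, LinearMap.mem_ker, LinearMap.pi_apply_eq_sum_univ f x]
  simp [mul_comm]

lemma comp_V (hp : p ≠ 2) (V : Submodule (ZMod p) (Fin n → ZMod p)) (hn : 0 < n)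
    (hV : Module.finrank (ZMod p) V = n - 1) (hbig : 75 / p ≤ pr (wt wm) V) :
    pr (wt wm) V ≤ 0.88 * pr (wt wn) V := by
  by_cases h : pr (wt wn) V < 0.6
  · obtain ⟨a, ha⟩ := hyper V hn hV
    have e : ∀ w : ZMod p → ℝ, pr (wt w) V =
        ∑ x : Fin n → ZMod p, wt w x * ind (∑ i, a i * x i = 0) := by
      intro w
      unfold pr
      exact sum_congr rfl (fun x _ => by rw [ind_congr (ha x)])
    have := hyper_compare hp a (by rw [← e]; exact h)
    rw [← e, ← e] at this
    have e3 : (0.75 : ℝ) / p = 0.01 * (75 / p) := by ring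
    rw [e3] at this
    have := pr_nonneg (wt_nonneg (n := n) (wn_nonneg (p := p))) V
    linarith
  · have h2 := odl wm_nonneg wm_sum (wm_le hp) V
    rw [hV] at h2
    have : n - (n - 1) = 1 := by omega
    rw [this] at h2
    push Not at h
    linarith

/-- the main quantitative bound over `ZMod p` -/
lemma main_bound (hp : p ≠ 2) {q : ℕ} (hn : 0 < n) (hq : q < n) {τ : ℝ} (hτ : 0 < τ)
    (h1 : 75 / p ≤ τ) (h2 : (63 / 64 : ℝ) ^ q ≤ 0.01 * τ) :
    1 - bs (wt (wm (p := p))) (⊤ : Submodule (ZMod p) (Fin n → ZMod p)) n ≤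
      2 * n * (τ + (8/9) ^ (n - 1 - q) * (n - 1).choose q) := by
  have hm0 := wt_nonneg (n := n) (wm_nonneg (p := p))
  have hn0 := wt_nonneg (n := n) (wn_nonneg (p := p))
  have hm1 := wt_sum (n := n) (wm_sum (p := p))
  have hn1 := wt_sum (n := n) (wn_sum (p := p))
  refine (s_lower hm0 hm1 (odl wm_nonneg wm_sum (wm_le hp))).trans ?_
  refine mul_le_mul_of_nonneg_left ?_ (by positivity)
  have key := dd_bound (N := n - 1) (m := n - 1 - q) hm0 hm1 hn0 hn1 (by omega) hτ.le
    (R := (8/9) ^ (n - 1 - q)) (by positivity) ?_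
  · have : n - 1 - (n - 1 - q) = q := by omega
    rw [this] at key
    exact key
  · intro V hV hVτ
    have c := comp_V hp V hn hV (h1.trans hVτ)
    have hpos : 0 < pr (wt wn) V := by linarith
    have b := bs_pow (ε := 0.01) (by norm_num : (0:ℝ) ≤ 63/64) (by norm_num) hn0
      (odl wn_nonneg wn_sum wn_le) V (n - 1 - q) (by
        refine (pow_le_pow_of_le_one (by norm_num) (by norm_num) (by omega : q ≤ _)).trans ?_
        refine h2.trans ?_
        linarith) (by norm_num)
    refine ⟨lt_of_lt_of_le (by positivity) b, ?_⟩
    refine le_trans ?_ (mul_le_mul_of_nonneg_left b (by positivity))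
    rw [← mul_pow]
    refine pow_le_pow_left₀ (pr_nonneg hm0 V) ?_ _
    linarith
end Exch
end KKS

namespace KKS
open Finset

section Final
variable {p : ℕ} [Fact p.Prime]

noncomputable def prob (d : ℕ) : ℝ :=
  (Nat.card {f : Matrix (Fin d) (Fin d) Bool //
        (Matrix.of fun i j => if f i j then (1 : ℝ) else -1).det = 0} : ℝ) / 2 ^ (d * d)

lemma det_to_li (d : ℕ) (f : Matrix (Fin d) (Fin d) Bool)
    (h : (Matrix.of fun i j => if f i j then (1 : ℝ) else -1).det = 0) :
    ¬ LinearIndependent (ZMod p) (fun i j => if f i j then (1 : ZMod p) else -1) := by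
  let M : Matrix (Fin d) (Fin d) ℤ := Matrix.of fun i j => if f i j then (1 : ℤ) else -1
  have e1 : (Matrix.of fun i j => if f i j then (1 : ℝ) else -1) = (Int.castRingHom ℝ).mapMatrix M := by
    ext i j; simp only [M, of_apply, RingHom.mapMatrix_apply, map_apply]; split_ifs <;> simp
  have e2 : (Matrix.of fun i j => if f i j then (1 : ZMod p) else -1) =
      (Int.castRingHom (ZMod p)).mapMatrix M := by
    ext i j; simp only [M, of_apply, RingHom.mapMatrix_apply, map_apply]; split_ifs <;> simp
  rw [e1, ← RingHom.map_det] at h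
  have h0 : M.det = 0 := by simpa using h
  have h2 : (Matrix.of fun i j => if f i j then (1 : ZMod p) else -1).det = 0 := by
    rw [e2, ← RingHom.map_det, h0]; simp
  intro hl
  have hl' : LinearIndependent (ZMod p) (Matrix.of fun i j => if f i j then (1 : ZMod p) else -1).row := hl
  rw [Matrix.linearIndependent_rows_iff_isUnit, Matrix.isUnit_iff_isUnit_det, h2] at hl'
  simp at hl'

lemma prob_le (hp : p ≠ 2) (d : ℕ) :
    prob d ≤ 1 - bs (wt (wm (p := p))) (⊤ : Submodule (ZMod p) (Fin d → ZMod p)) d := by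
  classical
  have hne := one_ne_neg hp
  have e1 : 1 - bs (wt (wm (p := p))) (⊤ : Submodule (ZMod p) (Fin d → ZMod p)) d =
      ∑ v : Fin d → Fin d → ZMod p, pw (wt wm) v * ind (¬ LinearIndependent (ZMod p) v) := by
    rw [← pw_sum (ι := Fin d) (wt_sum (n := d) (wm_sum (p := p)))]
    unfold bs
    rw [← sum_sub_distrib]
    refine sum_congr rfl (fun v _ => ?_)
    rw [ind_not]
    have : ind (LinearIndependent (ZMod p) v ∧ ∀ j, v j ∈ (⊤ : Submodule (ZMod p) (Fin d → ZMod p))) =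
      ind (LinearIndependent (ZMod p) v) := ind_congr (by simp)
    rw [this]; ring
  have e2 : ∑ f : Matrix (Fin d) (Fin d) Bool, (1/2 : ℝ) ^ (d * d) *
      ind (¬ LinearIndependent (ZMod p) (fun i j => if f i j then (1 : ZMod p) else -1)) =
      ∑ v : Fin d → Fin d → ZMod p, pw (wt wm) v * ind (¬ LinearIndependent (ZMod p) v) := by
    refine Fintype.sum_of_injective
      (fun f : Matrix (Fin d) (Fin d) Bool => fun i j => if f i j then (1 : ZMod p) else -1) ?_ _ _ ?_ ?_
    · intro f g hfg
      ext i j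
      have := congrFun (congrFun hfg i) j
      simp only at this
      have hne2 := hne.symm
      cases h1 : f i j <;> cases h2 : g i j <;> simp only [h1, h2] at this <;> first | rfl | exact absurd this (by simpa using hne) | exact absurd this (by simpa using hne2)
    · intro v hv
      have : ∃ i j, v i j ≠ 1 ∧ v i j ≠ -1 := by
        by_contra hc
        push Not at hc
        apply hv
        refine ⟨fun i j => decide (v i j = 1), ?_⟩
        ext i j
        by_cases h : v i j = 1
        · simp [h]
        · have h3 := hc i j h
          simp only [h3]
          simp
          exact fun h4 => h4.symm
      obtain ⟨i, j, h1, h2⟩ := this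
      have : pw (wt wm) v = 0 := by
        refine prod_eq_zero (mem_univ i) (prod_eq_zero (mem_univ j) ?_)
        unfold wm
        rw [ind_neg h1, ind_neg h2]; norm_num
      rw [this, zero_mul]
    · intro f
      congr 1
      unfold pw wt
      have : ∀ i j, wm (if f i j then (1 : ZMod p) else -1) = 1/2 := by
        intro i j
        unfold wm
        split_ifs
        · rw [ind_pos rfl, ind_neg hne]; norm_num
        · rw [ind_pos rfl, ind_neg hne.symm]; norm_num
      simp only [this]
      simp [pow_mul]
  rw [e1, ← e2, ← mul_sum]
  unfold prob
  rw [div_eq_inv_mul, one_div, inv_pow]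
  refine mul_le_mul_of_nonneg_left ?_ (by positivity)
  rw [Nat.card_eq_fintype_card, Fintype.card_subtype, ← sum_ind_card]
  exact sum_le_sum (fun f _ => ind_mono (det_to_li d f))

lemma prob_lt_one (d : ℕ) : prob d < 1 := by
  have : Fact (Nat.Prime 3) := ⟨Nat.prime_three⟩
  have h := prob_le (p := 3) (by norm_num) d
  have := s_pos (wt_nonneg (n := d) (wm_nonneg (p := 3))) (wt_sum wm_sum)
    (odl wm_nonneg wm_sum (wm_le (by norm_num)))
  linarith

lemma choose_le (n q : ℕ) : (n.choose q : ℝ) ≤ 100 ^ q * (101 / 100) ^ n := by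
  by_cases h : q ≤ n
  · have := add_pow (1/100 : ℝ) 1 n
    have h2 := single_le_sum (s := range (n+1))
      (f := fun m => (1/100 : ℝ) ^ m * 1 ^ (n - m) * (n.choose m))
      (fun _ _ => by positivity) (mem_range.2 (Nat.lt_succ_of_le h))
    rw [← this] at h2
    simp only [one_pow, mul_one] at h2
    have e : (1/100 + 1 : ℝ) = 101/100 := by norm_num
    rw [e] at h2
    have h3 : (100 : ℝ) ^ q * ((1/100) ^ q * (n.choose q)) = n.choose q := by
      rw [← mul_assoc, ← mul_pow]; norm_num
    rw [← h3]
    exact mul_le_mul_of_nonneg_left h2 (by positivity)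
  · rw [Nat.choose_eq_zero_of_lt (by omega)]; push_cast; positivity

lemma second_term (d q : ℕ) (hq : q = d / 100) (hq1 : 1 ≤ q) :
    (8/9 : ℝ) ^ (d - 1 - q) * (d - 1).choose q ≤ 4 * (99/100) ^ q := by
  have h1 : (8/9 : ℝ) ^ (d - 1 - q) ≤ (8/9) ^ (98 * q) * 1 := by
    rw [mul_one]
    exact pow_le_pow_of_le_one (by norm_num) (by norm_num) (by omega)
  have h2 : ((d - 1).choose q : ℝ) ≤ 100 ^ q * (101 / 100) ^ (100 * q + 100) :=
    (choose_le _ _).trans (mul_le_mul_of_nonneg_left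
      (pow_le_pow_right₀ (by norm_num) (by omega)) (by positivity))
  refine (mul_le_mul h1 h2 (by positivity) (by positivity)).trans ?_
  have e : (8/9 : ℝ) ^ (98 * q) * 1 * (100 ^ q * (101 / 100) ^ (100 * q + 100)) =
      (101/100) ^ 100 * ((8/9) ^ 98 * 100 * (101/100) ^ 100) ^ q := by
    rw [pow_add, pow_mul, pow_mul, mul_pow, mul_pow]; ring
  rw [e]
  refine mul_le_mul (by norm_num) (pow_le_pow_left₀ (by positivity) (by norm_num) q)
    (by positivity) (by norm_num)

lemma prob_big (d q : ℕ) (hq : q = d / 100) (hq1 : 1 ≤ q)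
    (h2 : (63 / 64 : ℝ) ^ q ≤ 0.01 * (99/100) ^ q) : prob d ≤ 10 * d * (99/100) ^ q := by
  have hτ : (0:ℝ) < (99/100) ^ q := by positivity
  obtain ⟨P, hP, hPp⟩ := Nat.exists_infinite_primes (max 3 ⌈75 / (99/100 : ℝ) ^ q⌉₊)
  have : Fact P.Prime := ⟨hPp⟩
  have hP3 : 3 ≤ P := (le_max_left _ _).trans hP
  have hPτ : 75 / (99/100 : ℝ) ^ q ≤ P :=
    (Nat.le_ceil _).trans (by exact_mod_cast (le_max_right _ _).trans hP)
  have hP0 : (0:ℝ) < P := by exact_mod_cast hPp.pos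
  have h := main_bound (p := P) (n := d) (q := q) (by omega) (by omega) (by omega) hτ
    (by rw [div_le_iff₀ hτ] at hPτ; rw [div_le_iff₀ hP0]; linarith) h2
  refine (prob_le (p := P) (by omega) d).trans (h.trans ?_)
  have := second_term d q hq hq1
  have hd : (0:ℝ) ≤ d := by positivity
  nlinarith

open Filter Topology in
lemma ev : ∃ Q : ℕ, ∀ q, Q ≤ q → (63 / 64 : ℝ) ^ q ≤ 0.01 * (99/100) ^ q ∧
    1000 * (q + 1) * (99/100 : ℝ) ^ q ≤ 0.995 ^ (q + 1) := by
  have t1 : Tendsto (fun q : ℕ => (175/176 : ℝ) ^ q) atTop (𝓝 0) :=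
    tendsto_pow_atTop_nhds_zero_of_lt_one (by norm_num) (by norm_num)
  have t2 : Tendsto (fun q : ℕ => 1000 * (q * (198/199 : ℝ) ^ q) + 1000 * (198/199 : ℝ) ^ q) atTop (𝓝 0) := by
    have a := tendsto_self_mul_const_pow_of_lt_one (r := (198/199 : ℝ)) (by norm_num) (by norm_num)
    have b : Tendsto (fun q : ℕ => (198/199 : ℝ) ^ q) atTop (𝓝 0) :=
      tendsto_pow_atTop_nhds_zero_of_lt_one (by norm_num) (by norm_num)
    simpa using (a.const_mul 1000).add (b.const_mul 1000)
  have e1 := t1.eventually (ge_mem_nhds (by norm_num : (0:ℝ) < 0.01))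
  have e2 := t2.eventually (ge_mem_nhds (by norm_num : (0:ℝ) < 0.995))
  obtain ⟨Q, hQ⟩ := eventually_atTop.1 (e1.and e2)
  refine ⟨Q, fun q hq => ?_⟩
  obtain ⟨a, b⟩ := hQ q hq
  constructor
  · have e : (63/64 : ℝ) ^ q = (175/176) ^ q * (99/100) ^ q := by
      rw [← mul_pow]; norm_num
    rw [e]
    exact mul_le_mul_of_nonneg_right a (by positivity)
  · have e : (99/100 : ℝ) ^ q = (198/199) ^ q * 0.995 ^ q := by
      rw [← mul_pow]; norm_num
    rw [e, pow_succ]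
    have h : (0:ℝ) ≤ 0.995 ^ q := by positivity
    have := mul_le_mul_of_nonneg_right b h
    linarith

lemma small (D : ℕ) : ∃ δ : ℝ, 0 ≤ δ ∧ δ < 1 ∧ ∀ d < D, prob d ≤ δ := by
  induction D with
  | zero => exact ⟨0, le_rfl, by norm_num, fun d hd => by omega⟩
  | succ D ih =>
    obtain ⟨δ, h0, h1, h⟩ := ih
    refine ⟨max δ (prob D), le_max_of_le_left h0, max_lt h1 (prob_lt_one D), fun d hd => ?_⟩
    rcases Nat.lt_succ_iff_lt_or_eq.1 hd with h' | rfl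
    · exact le_max_of_le_left (h d h')
    · exact le_max_right _ _

lemma final : ∃ α : ℝ, 0 ≤ α ∧ α < 1 ∧ ∀ d : ℕ, prob d ≤ α ^ d := by
  obtain ⟨Q, hQ⟩ := ev
  set D := 100 * (Q + 1) with hD
  obtain ⟨δ, hδ0, hδ1, hδ⟩ := small D
  set α2 : ℝ := 1 - (1 - δ) / (D + 1) with hα2
  have hDpos : (0:ℝ) < D + 1 := by positivity
  have hx0 : 0 < (1 - δ) / (D + 1) := div_pos (by linarith) hDpos
  have hx1 : (1 - δ) / (D + 1) ≤ 1 := by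
    rw [div_le_one hDpos]
    have : (0:ℝ) ≤ D := by positivity
    linarith
  refine ⟨max 0.99995 α2, le_max_of_le_left (by norm_num), max_lt (by norm_num) (by linarith), ?_⟩
  intro d
  by_cases hd : d < D
  · refine (hδ d hd).trans ?_
    refine le_trans ?_ (pow_le_pow_left₀ (by linarith) (le_max_right _ _) d)
    have hb := one_add_mul_le_pow (a := -((1 - δ) / (D + 1))) (by linarith) d
    have e : (1 + -((1 - δ) / (D + 1))) = α2 := by rw [hα2]; ring
    rw [e] at hb
    refine le_trans ?_ hb
    have hdD : (d:ℝ) ≤ D + 1 := by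
      have : (d:ℝ) < D := by exact_mod_cast hd
      linarith
    have h1 : (d:ℝ) * ((1 - δ) / (D + 1)) ≤ (D + 1) * ((1 - δ) / (D + 1)) :=
      mul_le_mul_of_nonneg_right hdD hx0.le
    rw [mul_div_cancel₀ _ hDpos.ne'] at h1
    linarith
  · refine le_trans ?_ (pow_le_pow_left₀ (by norm_num) (le_max_left _ _) d)
    obtain ⟨a, b⟩ := hQ (d / 100) (by omega)
    refine (prob_big d (d / 100) rfl (by omega) a).trans ?_
    have hd2 : d ≤ 100 * (d / 100 + 1) := by omega
    have hd3 : (d:ℝ) ≤ 100 * (((d / 100 : ℕ) : ℝ) + 1) := by exact_mod_cast hd2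
    have h1 : (0.99995 : ℝ) ^ (100 * (d / 100 + 1)) ≤ 0.99995 ^ d :=
      pow_le_pow_of_le_one (by norm_num) (by norm_num) hd2
    refine le_trans ?_ h1
    rw [pow_mul]
    have h2 : (0.995 : ℝ) ≤ 0.99995 ^ 100 := by norm_num
    refine le_trans ?_ (pow_le_pow_left₀ (by norm_num) h2 _)
    refine le_trans ?_ b
    refine mul_le_mul_of_nonneg_right ?_ (by positivity)
    linarith

end Final
end KKS

/-- Kahn–Komlós–Szemerédi: a random `±1` matrix is singular with probability at
most `α^d` for some absolute constant `α < 1`. -/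
theorem pm_one_singular_prob : ∃ α : ℝ, 0 ≤ α ∧ α < 1 ∧ ∀ d : ℕ,
    (Nat.card {f : Matrix (Fin d) (Fin d) Bool //
        (Matrix.of fun i j => if f i j then (1 : ℝ) else -1).det = 0} : ℝ) /
      2 ^ (d * d) ≤ α ^ d := by
  exact KKS.final
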